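/- For every natural number n, the following identity of polynomials in y and q holds: Σ_{π ∈ Π_n} y^{|π|} q^{cro*(π)} = Σ over Motzkin paths P of length n of (Π over up steps of P starting at height h of y·q^h) · (Π over level steps of P starting at height h of (y·q^h + [h]_q)) · (Π over down steps of P starting at height h of [h]_q), where [h]_q = 1+q+…+q^{h-1}. -/

import Mathlib

open Finset

inductive Step : Type
  | U | L | D
deriving DecidableEq

instance : Fintype Step where
  elems := {.U, .L, .D}
  complete := by intro x; cases x <;> simp

/-- The vertical displacement of a step: up = +1, level = 0, down = -1. -/
def Step.val : Step → ℤ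
  | .U => 1
  | .L => 0
  | .D => -1

/-- The partial sum of the step values of the first `i` steps;
this is the height at which step `i` starts. -/
def hsum {n : ℕ} (P : Fin n → Step) (i : ℕ) : ℤ :=
  ∑ j ∈ Finset.univ.filter (fun j : Fin n => (j : ℕ) < i), (P j).val

/-- A Motzkin path: all partial sums nonnegative and total sum 0. -/
abbrev IsMotzkin {n : ℕ} (P : Fin n → Step) : Prop :=
  (∀ i : Fin (n+1), 0 ≤ hsum P (i : ℕ)) ∧ hsum P n = 0

/-- A Motzkin prefix of final height `k`: all partial sums nonnegative, total sum `k`. -/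
abbrev IsMPrefix {n : ℕ} (P : Fin n → Step) (k : ℕ) : Prop :=
  (∀ i : Fin (n+1), 0 ≤ hsum P (i : ℕ)) ∧ hsum P n = (k : ℤ)

/-- `[h]_q = 1 + q + ... + q^(h-1)`. -/
def geo {R : Type*} [CommSemiring R] (q : R) (h : ℤ) : R :=
  ∑ i ∈ Finset.range h.toNat, q ^ i

/-- The Gaussian (q-)binomial coefficient, via the q-Pascal recurrence. -/
def qbinom {R : Type*} [CommSemiring R] (q : R) : ℕ → ℕ → R
  | _, 0 => 1
  | 0, _+1 => 0
  | n+1, k+1 => qbinom q n k + q ^ (k+1) * qbinom q n (k+1)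

/-- The binomial coefficient with integer lower argument, zero on negative arguments. -/
def ch (m : ℕ) (j : ℤ) : ℤ := if 0 ≤ j then m.choose j.toNat else 0

/-- A set partition of `Fin n`, given as the finset of its blocks:
blocks are nonempty and every element lies in exactly one block. -/
abbrev IsPartition {n : ℕ} (P : Finset (Finset (Fin n))) : Prop :=
  (∀ B ∈ P, B.Nonempty) ∧ ∀ x : Fin n, (P.filter (fun B => x ∈ B)).card = 1

/-- `(a, b)` is an arc of the partition `P`: `a < b`, they lie in a common block,
and no element of that block is strictly between them. -/
abbrev IsArc {n : ℕ} (P : Finset (Finset (Fin n))) (a b : Fin n) : Prop :=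
  a < b ∧ ∃ B ∈ P, a ∈ B ∧ b ∈ B ∧ ∀ c ∈ B, ¬(a < c ∧ c < b)

/-- The number of crossings of a set partition: pairs of arcs `(i,j)`, `(k,l)`
with `i < k < j < l`. -/
def croP {n : ℕ} (P : Finset (Finset (Fin n))) : ℕ :=
  (Finset.univ.filter (fun x : (Fin n × Fin n) × (Fin n × Fin n) =>
    IsArc P x.1.1 x.1.2 ∧ IsArc P x.2.1 x.2.2 ∧
    x.1.1 < x.2.1 ∧ x.2.1 < x.1.2 ∧ x.1.2 < x.2.2)).card

/-- The modified crossing number `cro*`: crossings, plus pairs of a block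
maximum `m` and an arc `(k,l)` with `k < m < l`. -/
def croStar {n : ℕ} (P : Finset (Finset (Fin n))) : ℕ :=
  croP P +
  (Finset.univ.filter (fun x : Fin n × Fin n × Fin n =>
    (∃ B ∈ P, x.1 ∈ B ∧ ∀ y ∈ B, y ≤ x.1) ∧
    IsArc P x.2.1 x.2.2 ∧ x.2.1 < x.1 ∧ x.1 < x.2.2)).card

section part1
variable {R : Type*} [CommRing R] (y q : R)

def wt6 : Step → ℤ → R
  | .U, h => y * q ^ h.toNat
  | .L, h => y * q ^ h.toNat + geo q h
  | .D, h => geo q h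

lemma hsum_snoc_le {n : ℕ} (P : Fin n → Step) (s : Step) (i : ℕ) (hi : i ≤ n) :
    hsum (Fin.snoc P s : Fin (n+1) → Step) i = hsum P i := by
  unfold hsum
  rw [Finset.sum_filter, Finset.sum_filter, Fin.sum_univ_castSucc]
  simp [Nat.not_lt.mpr hi]

lemma hsum_snoc_last {n : ℕ} (P : Fin n → Step) (s : Step) :
    hsum (Fin.snoc P s : Fin (n+1) → Step) (n+1) = hsum P n + s.val := by
  unfold hsum
  rw [Finset.sum_filter, Finset.sum_filter, Fin.sum_univ_castSucc]
  simp only [Fin.val_castSucc, Fin.snoc_castSucc, Fin.val_last, Fin.snoc_last]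
  congr 1
  · apply Finset.sum_congr rfl
    intro x _
    have := x.2
    rw [if_pos (by omega), if_pos this]
  · simp

def pre6 (n : ℕ) (k : ℤ) : R :=
  ∑ P : Fin n → Step, if (∀ i : Fin (n+1), 0 ≤ hsum P (i : ℕ)) ∧ hsum P n = k then
    ∏ i : Fin n, wt6 y q (P i) (hsum P (i : ℕ)) else 0

lemma cond_snoc {n : ℕ} (P : Fin n → Step) (s : Step) (k : ℤ) (hk : 0 ≤ k) :
    ((∀ i : Fin (n+1+1), 0 ≤ hsum (Fin.snoc P s : Fin (n+1) → Step) (i : ℕ)) ∧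
      hsum (Fin.snoc P s : Fin (n+1) → Step) (n+1) = k) ↔
    ((∀ i : Fin (n+1), 0 ≤ hsum P (i : ℕ)) ∧ hsum P n = k - s.val) := by
  rw [Fin.forall_fin_succ', hsum_snoc_last]
  simp only [Fin.val_castSucc, Fin.val_last, hsum_snoc_last]
  have : ∀ i : Fin (n+1), hsum (Fin.snoc P s : Fin (n+1) → Step) (i : ℕ) = hsum P i :=
    fun i => hsum_snoc_le P s i (by have := i.2; omega)
  simp only [this]
  constructor
  · rintro ⟨⟨h1, h2⟩, h3⟩
    exact ⟨h1, by omega⟩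
  · rintro ⟨h1, h3⟩
    exact ⟨⟨h1, by omega⟩, by omega⟩

lemma pre6_succ (n : ℕ) (k : ℤ) (hk : 0 ≤ k) :
    pre6 y q (n+1) k = ∑ s : Step, pre6 y q n (k - s.val) * wt6 y q s (k - s.val) := by
  unfold pre6
  rw [← (Fin.snocEquiv (fun _ : Fin (n+1) => Step)).sum_comp, Fintype.sum_prod_type]
  apply Finset.sum_congr rfl
  intro s _
  rw [Finset.sum_mul]
  apply Finset.sum_congr rfl
  intro P _
  have e : (Fin.snocEquiv (fun _ : Fin (n+1) => Step)) (s, P) = (Fin.snoc P s : Fin (n+1) → Step) := rfl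
  simp only [e]
  rw [if_congr (cond_snoc P s k hk) rfl rfl]
  split_ifs with h
  · rw [Fin.prod_univ_castSucc]
    simp only [Fin.snoc_castSucc, Fin.snoc_last, Fin.val_castSucc, Fin.val_last]
    rw [hsum_snoc_le P s n le_rfl, h.2]
    congr 1
    apply Finset.prod_congr rfl
    intro i _
    rw [hsum_snoc_le P s i i.2.le]
  · simp

lemma pre6_neg (n : ℕ) (k : ℤ) (hk : k < 0) : pre6 y q n k = 0 := by
  unfold pre6
  apply Finset.sum_eq_zero
  intro P _
  rw [if_neg]
  rintro ⟨h1, h2⟩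
  have := h1 (Fin.last n)
  simp at this
  omega

def E6 : ℕ → ℕ → R
  | _, 0 => 1
  | 0, _+1 => 0
  | m+1, k+1 => q ^ k * E6 m k + q ^ (k+1) * E6 m (k+1)

def g6 (m : ℕ) : R := ∑ i ∈ Finset.range m, q ^ i

lemma g6_succ (m : ℕ) : g6 q (m+1) = 1 + q * g6 q m := by
  unfold g6
  rw [Finset.sum_range_succ', Finset.mul_sum]
  simp only [pow_succ]
  rw [add_comm]
  simp [mul_comm]

lemma E6_zero (m : ℕ) : E6 q m 0 = 1 := by cases m <;> rfl

lemma E6_id (m k : ℕ) : g6 q m * E6 q m k = g6 q k * E6 q m k + g6 q (k+1) * E6 q m (k+1) := by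
  induction m generalizing k with
  | zero =>
    cases k with
    | zero => simp [E6, g6]
    | succ k => simp [E6]
  | succ m ih =>
    cases k with
    | zero =>
      have := ih 0
      simp only [E6, E6_zero, g6_succ] at *
      simp only [g6, Finset.range_zero, Finset.sum_empty] at *
      linear_combination q * this
    | succ k =>
      have h1 := ih k
      have h2 := ih (k+1)
      have e1 := g6_succ q m
      have e2 := g6_succ q k
      have e3 := g6_succ q (k+1)
      simp only [E6] at *
      rw [e1]
      linear_combination q^(k+1) * h1 + q^(k+2) * h2 - q^k * E6 q m k * e2 - q^(k+1) * E6 q m (k+1) * e3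

end part1
section part2
open scoped Classical

def sb6 {n : ℕ} (P : Finset (Finset (Fin n))) (x y : Fin n) : Prop :=
  ∃ B ∈ P, x ∈ B ∧ y ∈ B

lemma isPartition_iff6 {n : ℕ} (P : Finset (Finset (Fin n))) :
    IsPartition P ↔ (∀ B ∈ P, B.Nonempty) ∧ (∀ x, ∃ B ∈ P, x ∈ B) ∧
      (∀ x, ∀ A ∈ P, ∀ B ∈ P, x ∈ A → x ∈ B → A = B) := by
  constructor
  · rintro ⟨h1, h2⟩
    refine ⟨h1, ?_, ?_⟩
    · intro x
      obtain ⟨B, hB⟩ := Finset.card_eq_one.mp (h2 x)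
      have : B ∈ P.filter (fun B => x ∈ B) := by rw [hB]; simp
      rw [Finset.mem_filter] at this
      exact ⟨B, this.1, this.2⟩
    · intro x A hA B hB hxA hxB
      exact Finset.card_le_one.mp (h2 x).le A (by simp [*]) B (by simp [*])
  · rintro ⟨h1, h2, h3⟩
    refine ⟨h1, fun x => ?_⟩
    obtain ⟨B, hB, hx⟩ := h2 x
    rw [Finset.card_eq_one]
    refine ⟨B, ?_⟩
    ext A
    simp only [Finset.mem_filter, Finset.mem_singleton]
    constructor
    · rintro ⟨hA, hxA⟩
      exact h3 x A hA B hB hxA hx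
    · rintro rfl
      exact ⟨hB, hx⟩

def T6 {n : ℕ} (r : Fin n → Fin n → Prop) (i b j : Fin n) : Prop :=
  i < b ∧ b < j ∧ r i j ∧ (∀ c, r i c → ¬ (i < c ∧ c < j)) ∧ (∀ c, r b c → c ≤ j → c ≤ b)

section P
variable {n : ℕ} {P : Finset (Finset (Fin n))} (hP : IsPartition P)
include hP

lemma sb6_refl (x : Fin n) : sb6 P x x := by
  obtain ⟨B, hB, hx⟩ := ((isPartition_iff6 P).mp hP).2.1 x
  exact ⟨B, hB, hx, hx⟩

lemma sb6_iff {x : Fin n} {B : Finset (Fin n)} (hB : B ∈ P) (hx : x ∈ B) (y : Fin n) :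
    sb6 P x y ↔ y ∈ B := by
  constructor
  · rintro ⟨A, hA, h1, h2⟩
    rwa [((isPartition_iff6 P).mp hP).2.2 x B hB A hA hx h1]
  · intro h
    exact ⟨B, hB, hx, h⟩

lemma isArc_iff6 (a b : Fin n) :
    IsArc P a b ↔ a < b ∧ sb6 P a b ∧ ∀ c, sb6 P a c → ¬ (a < c ∧ c < b) := by
  constructor
  · rintro ⟨h, B, hB, ha, hb, hc⟩
    refine ⟨h, ⟨B, hB, ha, hb⟩, ?_⟩
    intro c h'
    exact hc c ((sb6_iff hP hB ha c).mp h')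
  · rintro ⟨h, ⟨B, hB, ha, hb⟩, hc⟩
    exact ⟨h, B, hB, ha, hb, fun c h' => hc c ⟨B, hB, ha, h'⟩⟩

lemma isMax_iff6 (m : Fin n) :
    (∃ B ∈ P, m ∈ B ∧ ∀ y ∈ B, y ≤ m) ↔ ∀ c, sb6 P m c → c ≤ m := by
  constructor
  · rintro ⟨B, hB, hm, h⟩ c hc
    exact h c ((sb6_iff hP hB hm c).mp hc)
  · intro h
    obtain ⟨B, hB, hm⟩ := ((isPartition_iff6 P).mp hP).2.1 m
    exact ⟨B, hB, hm, fun y hy => h y ⟨B, hB, hm, hy⟩⟩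

lemma next6 (b c : Fin n) (h : sb6 P b c) (hbc : b < c) : ∃ l, IsArc P b l := by
  have hne : (Finset.univ.filter (fun l => sb6 P b l ∧ b < l)).Nonempty :=
    ⟨c, by simp [h, hbc]⟩
  refine ⟨Finset.min' _ hne, ?_⟩
  have hm := Finset.min'_mem _ hne
  rw [Finset.mem_filter] at hm
  rw [isArc_iff6 hP]
  refine ⟨hm.2.2, hm.2.1, ?_⟩
  rintro d hd ⟨h1, h2⟩
  exact absurd (Finset.min'_le _ d (by simp [hd, h1])) (not_le.mpr h2)

lemma croStar_eq6 : croStar P =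
    (Finset.univ.filter (fun x : Fin n × Fin n × Fin n => T6 (sb6 P) x.1 x.2.1 x.2.2)).card := by
  rw [← Finset.card_filter_add_card_filter_not (fun x : Fin n × Fin n × Fin n => ∃ c, sb6 P x.2.1 c ∧ x.2.1 < c)]
  unfold croStar croP
  congr 1
  · apply Finset.card_bij (fun x _ => (x.1.1, x.2.1, x.1.2))
    · rintro ⟨⟨i, j⟩, ⟨k, l⟩⟩ h
      simp only [Finset.mem_filter, Finset.mem_univ, true_and] at h ⊢
      obtain ⟨h1, h2, h3, h4, h5⟩ := h
      rw [isArc_iff6 hP] at h1 h2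
      refine ⟨⟨h3, h4, h1.2.1, h1.2.2, ?_⟩, l, h2.2.1, h2.1⟩
      intro c hc hcj
      by_contra hh
      exact h2.2.2 c hc ⟨not_le.mp hh, lt_of_le_of_lt hcj h5⟩
    · rintro ⟨⟨i, j⟩, ⟨k, l⟩⟩ h ⟨⟨i', j'⟩, ⟨k', l'⟩⟩ h' e
      simp only [Finset.mem_filter, Finset.mem_univ, true_and, Prod.mk.injEq] at h h' e ⊢
      obtain ⟨rfl, rfl, rfl⟩ := e
      refine ⟨⟨rfl, rfl⟩, rfl, ?_⟩
      have h1 := (isArc_iff6 hP _ _).mp h.2.1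
      have h2 := (isArc_iff6 hP _ _).mp h'.2.1
      apply le_antisymm
      · by_contra hh
        exact h1.2.2 l' h2.2.1 ⟨h2.1, not_le.mp hh⟩
      · by_contra hh
        exact h2.2.2 l h1.2.1 ⟨h1.1, not_le.mp hh⟩
    · rintro ⟨i, b, j⟩ h
      simp only [Finset.mem_filter, Finset.mem_univ, true_and] at h
      obtain ⟨⟨h1, h2, h3, h4, h5⟩, c, hc, hbc⟩ := h
      obtain ⟨l, hl⟩ := next6 hP b c hc hbc
      have hl' := (isArc_iff6 hP _ _).mp hl
      refine ⟨((i, j), (b, l)), ?_, rfl⟩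
      simp only [Finset.mem_filter, Finset.mem_univ, true_and]
      refine ⟨(isArc_iff6 hP _ _).mpr ⟨h1.trans h2, h3, h4⟩, hl, h1, h2, ?_⟩
      by_contra hh
      exact absurd (h5 l hl'.2.1 (not_lt.mp hh)) (not_le.mpr hl'.1)
  · apply Finset.card_bij (fun x _ => (x.2.1, x.1, x.2.2))
    · rintro ⟨m, k, l⟩ h
      simp only [Finset.mem_filter, Finset.mem_univ, true_and] at h ⊢
      obtain ⟨h1, h2, h3, h4⟩ := h
      rw [isArc_iff6 hP] at h2
      rw [isMax_iff6 hP] at h1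
      refine ⟨⟨h3, h4, h2.2.1, h2.2.2, fun c hc _ => h1 c hc⟩, ?_⟩
      rintro ⟨c, hc, h⟩
      exact absurd (h1 c hc) (not_le.mpr h)
    · rintro ⟨m, k, l⟩ h ⟨m', k', l'⟩ h' e
      simp only [Prod.mk.injEq] at e ⊢
      tauto
    · rintro ⟨i, b, j⟩ h
      simp only [Finset.mem_filter, Finset.mem_univ, true_and] at h
      obtain ⟨⟨h1, h2, h3, h4, h5⟩, hc⟩ := h
      refine ⟨(b, i, j), ?_, rfl⟩
      simp only [Finset.mem_filter, Finset.mem_univ, true_and]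
      refine ⟨(isMax_iff6 hP _).mpr ?_, (isArc_iff6 hP _ _).mpr ⟨h1.trans h2, h3, h4⟩, h1, h2⟩
      intro c h
      by_contra hh
      exact hc ⟨c, h, not_le.mp hh⟩

/-- sums over blocks are sums over block maxima -/
lemma sum_max6 {R : Type*} [AddCommMonoid R] (f : Finset (Fin n) → R) (g : Fin n → R)
    (hfg : ∀ B ∈ P, ∀ i ∈ B, (∀ c ∈ B, c ≤ i) → f B = g i) :
    ∑ B ∈ P, f B = ∑ i ∈ Finset.univ.filter (fun i => ∀ c, sb6 P i c → c ≤ i), g i := by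
  apply Finset.sum_bij (fun B hB => B.max' (hP.1 B hB))
  · intro B hB
    simp only [Finset.mem_filter, Finset.mem_univ, true_and]
    intro c hc
    exact Finset.le_max' _ _ ((sb6_iff hP hB (Finset.max'_mem _ _) c).mp hc)
  · intro A hA B hB e
    refine ((isPartition_iff6 P).mp hP).2.2 _ A hA B hB (Finset.max'_mem _ (hP.1 A hA)) ?_
    rw [e]
    exact Finset.max'_mem _ _
  · intro b hb
    simp only [Finset.mem_filter, Finset.mem_univ, true_and] at hb
    obtain ⟨B, hB, hx⟩ := ((isPartition_iff6 P).mp hP).2.1 b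
    refine ⟨B, hB, ?_⟩
    apply le_antisymm
    · apply Finset.max'_le
      intro c hc
      exact hb c ⟨B, hB, hx, hc⟩
    · exact Finset.le_max' _ _ hx
  · intro B hB
    exact hfg B hB _ (Finset.max'_mem _ _) (fun c hc => Finset.le_max' _ _ hc)

end P

lemma geom6 {R : Type*} [CommRing R] (q : R) {n : ℕ} (S : Finset (Fin n)) :
    ∑ i ∈ S, q ^ (S.filter (fun b => i < b)).card = g6 q S.card := by
  induction S using Finset.induction_on_min with
  | empty => simp [g6]
  | insert a s ha ih =>
    have hn : a ∉ s := fun h => lt_irrefl _ (ha a h)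
    rw [Finset.sum_insert hn, Finset.card_insert_of_notMem hn]
    unfold g6 at *
    rw [Finset.sum_range_succ, ← ih, add_comm]
    congr 1
    · apply Finset.sum_congr rfl
      intro i hi
      congr 2
      rw [Finset.filter_insert, if_neg (not_lt.mpr (ha i hi).le)]
    · congr 2
      rw [Finset.filter_insert, if_neg (lt_irrefl _)]
      exact Finset.filter_true_of_mem ha

lemma T6_card_succ {n : ℕ} (r : Fin (n+1) → Fin (n+1) → Prop) (r0 : Fin n → Fin n → Prop)
    (h : ∀ x y, r (Fin.castSucc x) (Fin.castSucc y) ↔ r0 x y) :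
    (Finset.univ.filter (fun x : Fin (n+1) × Fin (n+1) × Fin (n+1) => T6 r x.1 x.2.1 x.2.2)).card =
    (Finset.univ.filter (fun x : Fin n × Fin n × Fin n => T6 r0 x.1 x.2.1 x.2.2)).card +
    (Finset.univ.filter (fun x : Fin n × Fin n => x.1 < x.2 ∧ r x.1.castSucc (Fin.last n) ∧
      (∀ c, r0 x.1 c → c ≤ x.1) ∧ (∀ c, r0 x.2 c → c ≤ x.2) ∧
        ¬ r x.2.castSucc (Fin.last n))).card := by
  have h1 : ∀ i b j : Fin n, T6 r i.castSucc b.castSucc j.castSucc ↔ T6 r0 i b j := by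
    intro i b j
    unfold T6
    simp [Fin.forall_fin_succ', h, Fin.castSucc_lt_last, (Fin.castSucc_lt_last _).not_ge, Fin.le_last]
  have h2 : ∀ i b : Fin n, T6 r i.castSucc b.castSucc (Fin.last n) ↔ 
      (i < b ∧ r i.castSucc (Fin.last n) ∧
      (∀ c, r0 i c → c ≤ i) ∧ (∀ c, r0 b c → c ≤ b) ∧ ¬ r b.castSucc (Fin.last n)) := by
    intro i b
    unfold T6
    simp [Fin.forall_fin_succ', h, Fin.castSucc_lt_last, (Fin.castSucc_lt_last _).not_ge,
      Fin.le_last]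
  have h3 : ∀ b j, ¬ T6 r (Fin.last n) b j := by
    intro b j hh
    exact absurd hh.1 (Fin.le_last _).not_gt
  have h4 : ∀ i j, ¬ T6 r i (Fin.last n) j := by
    intro i j hh
    exact absurd hh.2.1 (Fin.le_last _).not_gt
  simp only [Finset.card_filter, Fintype.sum_prod_type, Fin.sum_univ_castSucc, h1, h2, h3, h4]
  simp [Finset.sum_add_distrib]

end part2
section part3
open scoped Classical

def up6 {n : ℕ} (B : Finset (Fin n)) : Finset (Fin (n+1)) := B.map Fin.castSuccEmb
def dn6 {n : ℕ} (C : Finset (Fin (n+1))) : Finset (Fin n) :=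
  Finset.univ.filter (fun x => x.castSucc ∈ C)

@[simp] lemma mem_up6 {n : ℕ} (B : Finset (Fin n)) (x : Fin n) : x.castSucc ∈ up6 B ↔ x ∈ B := by
  simp [up6]
@[simp] lemma last_up6 {n : ℕ} (B : Finset (Fin n)) : ¬ Fin.last n ∈ up6 B := by
  simp [up6, Fin.castSucc_ne_last]
@[simp] lemma mem_dn6 {n : ℕ} (C : Finset (Fin (n+1))) (x : Fin n) :
    x ∈ dn6 C ↔ x.castSucc ∈ C := by
  simp [dn6]

lemma ext6 {n : ℕ} {A B : Finset (Fin (n+1))} (h : ∀ x : Fin n, x.castSucc ∈ A ↔ x.castSucc ∈ B)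
    (h' : Fin.last n ∈ A ↔ Fin.last n ∈ B) : A = B := by
  ext x
  induction x using Fin.lastCases with
  | last => exact h'
  | cast x => exact h x

lemma up6_inj {n : ℕ} {A B : Finset (Fin n)} (h : up6 A = up6 B) : A = B := by
  ext x
  rw [← mem_up6, h, mem_up6]

lemma iup6_inj {n : ℕ} {A B : Finset (Fin n)}
    (h : insert (Fin.last n) (up6 A) = insert (Fin.last n) (up6 B)) : A = B := by
  ext x
  have := Finset.ext_iff.mp h x.castSucc
  simpa [Fin.castSucc_ne_last] using this

lemma iup6_ne {n : ℕ} {A B : Finset (Fin n)} :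
    insert (Fin.last n) (up6 A) ≠ up6 B := by
  intro h
  have := Finset.ext_iff.mp h (Fin.last n)
  simp at this

def ad6 {n : ℕ} (P : Finset (Finset (Fin n))) (B : Finset (Fin n)) :
    Finset (Finset (Fin (n+1))) :=
  insert (insert (Fin.last n) (up6 B)) ((P.erase B).image up6)

lemma mem_ad6 {n : ℕ} (P : Finset (Finset (Fin n))) (B : Finset (Fin n)) (C : Finset (Fin (n+1))) :
    C ∈ ad6 P B ↔ C = insert (Fin.last n) (up6 B) ∨ ∃ A ∈ P, A ≠ B ∧ up6 A = C := by
  simp [ad6, and_assoc, and_left_comm]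

section P
variable {n : ℕ} {P : Finset (Finset (Fin n))}

lemma ad6_sb (hP : IsPartition P) {B : Finset (Fin n)} (hB : B ∈ insert ∅ P) (x z : Fin n) :
    sb6 (ad6 P B) x.castSucc z.castSucc ↔ sb6 P x z := by
  unfold sb6
  constructor
  · rintro ⟨C, hC, h1, h2⟩
    rw [mem_ad6] at hC
    rcases hC with rfl | ⟨A, hA, hne, rfl⟩
    · simp [Fin.castSucc_ne_last] at h1 h2
      rcases Finset.mem_insert.mp hB with rfl | hB
      · simp at h1
      · exact ⟨B, hB, h1, h2⟩
    · simp at h1 h2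
      exact ⟨A, hA, h1, h2⟩
  · rintro ⟨A, hA, h1, h2⟩
    by_cases h : A = B
    · subst h
      exact ⟨insert (Fin.last n) (up6 A), (mem_ad6 _ _ _).mpr (Or.inl rfl), by simp [h1], by simp [h2]⟩
    · exact ⟨up6 A, (mem_ad6 _ _ _).mpr (Or.inr ⟨A, hA, h, rfl⟩), by simp [h1], by simp [h2]⟩

lemma ad6_sb_last (B : Finset (Fin n)) (x : Fin n) :
    sb6 (ad6 P B) x.castSucc (Fin.last n) ↔ x ∈ B := by
  unfold sb6
  constructor
  · rintro ⟨C, hC, h1, h2⟩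
    rw [mem_ad6] at hC
    rcases hC with rfl | ⟨A, hA, hne, rfl⟩
    · simpa [Fin.castSucc_ne_last] using h1
    · simp at h2
  · intro h
    exact ⟨insert (Fin.last n) (up6 B), (mem_ad6 _ _ _).mpr (Or.inl rfl), by simp [h], by simp⟩

lemma ad6_part (hP : IsPartition P) {B : Finset (Fin n)} (hB : B ∈ insert ∅ P) :
    IsPartition (ad6 P B) := by
  have hP' := (isPartition_iff6 P).mp hP
  rw [isPartition_iff6]
  refine ⟨?_, ?_, ?_⟩
  · intro C hC
    rw [mem_ad6] at hC
    rcases hC with rfl | ⟨A, hA, hne, rfl⟩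
    · exact Finset.insert_nonempty _ _
    · obtain ⟨x, hx⟩ := hP.1 A hA
      exact ⟨x.castSucc, by simpa using hx⟩
  · intro x
    induction x using Fin.lastCases with
    | last => exact ⟨_, (mem_ad6 _ _ _).mpr (Or.inl rfl), by simp⟩
    | cast x =>
      obtain ⟨C, hC, h, _⟩ := (ad6_sb hP hB x x).mpr (sb6_refl hP x)
      exact ⟨C, hC, h⟩
  · have key : ∀ A ∈ P, A ≠ B → ∀ x, x ∈ A → x ∈ B → False := by
      intro A hA hne x h1 h2
      rcases Finset.mem_insert.mp hB with rfl | hB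
      · simp at h2
      · exact hne (hP'.2.2 x A hA B hB h1 h2)
    intro x C hC D hD h1 h2
    rw [mem_ad6] at hC hD
    induction x using Fin.lastCases with
    | last =>
      rcases hC with rfl | ⟨A, hA, hne, rfl⟩
      · rcases hD with rfl | ⟨A, hA, hne, rfl⟩
        · rfl
        · simp at h2
      · simp at h1
    | cast x =>
      rcases hC with rfl | ⟨A, hA, hne, rfl⟩
      · rcases hD with rfl | ⟨A', hA', hne', rfl⟩
        · rfl
        · simp [Fin.castSucc_ne_last] at h1 h2
          exact (key A' hA' hne' x h2 h1).elim
      · rcases hD with rfl | ⟨A', hA', hne', rfl⟩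
        · simp [Fin.castSucc_ne_last] at h1 h2
          exact (key A hA hne x h1 h2).elim
        · simp at h1 h2
          rw [hP'.2.2 x A hA A' hA' h1 h2]

lemma ad6_card (B : Finset (Fin n)) : (ad6 P B).card = (P.erase B).card + 1 := by
  unfold ad6
  rw [Finset.card_insert_of_notMem, Finset.card_image_of_injective]
  · intro A B h
    exact up6_inj h
  · intro h
    obtain ⟨A, _, h⟩ := Finset.mem_image.mp h
    exact iup6_ne h.symm

lemma ad6_inj {P' : Finset (Finset (Fin n))} (hP : IsPartition P) (hP' : IsPartition P')
    {B B' : Finset (Fin n)} (hB : B ∈ insert ∅ P) (hB' : B' ∈ insert ∅ P')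
    (h : ad6 P B = ad6 P' B') : P = P' ∧ B = B' := by
  have e : B = B' := by
    have : insert (Fin.last n) (up6 B) ∈ ad6 P' B' := by
      rw [← h, mem_ad6]; left; rfl
    rw [mem_ad6] at this
    rcases this with h | ⟨A, _, _, h⟩
    · exact iup6_inj h
    · exact (iup6_ne h.symm).elim
  subst e
  refine ⟨?_, rfl⟩
  have key : ∀ P P' : Finset (Finset (Fin n)), IsPartition P → IsPartition P' → B ∈ insert ∅ P →
      B ∈ insert ∅ P' → ad6 P B = ad6 P' B → P ⊆ P' := by
    intro P P' hP hP' hB hB' h A hA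
    by_cases e : A = B
    · subst e
      rcases Finset.mem_insert.mp hB' with h | h
      · exact absurd (hP.1 A hA) (by simp [h])
      · exact h
    · have : up6 A ∈ ad6 P' B := by
        rw [← h, mem_ad6]; right; exact ⟨A, hA, e, rfl⟩
      rw [mem_ad6] at this
      rcases this with h | ⟨A', hA', _, h⟩
      · exact (iup6_ne h.symm).elim
      · rwa [← up6_inj h]
  exact Finset.Subset.antisymm (key _ _ hP hP' hB hB' h) (key _ _ hP' hP hB' hB h.symm)

lemma ad6_surj {Q : Finset (Finset (Fin (n+1)))} (hQ : IsPartition Q) :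
    ∃ P B, IsPartition P ∧ B ∈ insert ∅ P ∧ ad6 P B = Q := by
  have hQ' := (isPartition_iff6 Q).mp hQ
  obtain ⟨C, hC, hl⟩ := hQ'.2.1 (Fin.last n)
  have hmem : ∀ A, A ∈ (Q.image dn6).erase ∅ ↔ A ≠ ∅ ∧ ∃ D ∈ Q, dn6 D = A := by
    intro A; simp
  have hC' : insert (Fin.last n) (up6 (dn6 C)) = C := by
    apply ext6
    · intro x; simp [Fin.castSucc_ne_last]
    · simp [hl]
  have hud : ∀ D ∈ Q, D ≠ C → up6 (dn6 D) = D := by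
    intro D hD hne
    apply ext6
    · intro x; simp
    · simp only [last_up6, false_iff]
      intro h
      exact hne (hQ'.2.2 _ D hD C hC h hl)
  refine ⟨(Q.image dn6).erase ∅, dn6 C, ?_, ?_, ?_⟩
  · rw [isPartition_iff6]
    refine ⟨?_, ?_, ?_⟩
    · intro B hB
      exact Finset.nonempty_iff_ne_empty.mpr ((hmem B).mp hB).1
    · intro x
      obtain ⟨D, hD, hx⟩ := hQ'.2.1 x.castSucc
      have hx' : x ∈ dn6 D := by simpa using hx
      exact ⟨dn6 D, (hmem _).mpr ⟨Finset.ne_empty_of_mem hx', D, hD, rfl⟩, hx'⟩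
    · intro x A hA B hB h1 h2
      obtain ⟨_, D, hD, rfl⟩ := (hmem _).mp hA
      obtain ⟨_, D', hD', rfl⟩ := (hmem _).mp hB
      rw [hQ'.2.2 x.castSucc D hD D' hD' (by simpa using h1) (by simpa using h2)]
  · rw [Finset.mem_insert, hmem]
    by_cases h : dn6 C = ∅
    · left; exact h
    · right; exact ⟨h, C, hC, rfl⟩
  · ext D
    rw [mem_ad6, hC']
    constructor
    · rintro (rfl | ⟨A, hA, hne, rfl⟩)
      · exact hC
      · obtain ⟨_, D', hD', rfl⟩ := (hmem _).mp hA
        have : D' ≠ C := by rintro rfl; exact hne rfl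
        rwa [hud D' hD' this]
    · intro hD
      by_cases e : D = C
      · left; exact e
      · right
        obtain ⟨x, hx⟩ := hQ.1 D hD
        have hx0 : ∃ x : Fin n, x.castSucc ∈ D := by
          induction x using Fin.lastCases with
          | last => exact (e (hQ'.2.2 _ D hD C hC hx hl)).elim
          | cast x => exact ⟨x, hx⟩
        obtain ⟨x, hx⟩ := hx0
        have hx' : x ∈ dn6 D := by simpa using hx
        refine ⟨dn6 D, (hmem _).mpr ⟨Finset.ne_empty_of_mem hx', D, hD, rfl⟩, ?_, hud D hD e⟩
        intro h
        rw [h] at hx'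
        exact e (hQ'.2.2 _ D hD C hC hx (by simpa using hx'))

lemma croStar_ad6 (hP : IsPartition P) {B : Finset (Fin n)} (hB : B ∈ insert ∅ P) :
    croStar (ad6 P B) = croStar P +
    (Finset.univ.filter (fun x : Fin n × Fin n => x.1 < x.2 ∧ x.1 ∈ B ∧
      (∀ c, sb6 P x.1 c → c ≤ x.1) ∧ (∀ c, sb6 P x.2 c → c ≤ x.2) ∧ x.2 ∉ B)).card := by
  rw [croStar_eq6 (ad6_part hP hB), croStar_eq6 hP, T6_card_succ _ _ (ad6_sb hP hB)]
  simp only [ad6_sb_last]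

lemma croStar_ad6_empty (hP : IsPartition P) : croStar (ad6 P ∅) = croStar P := by
  rw [croStar_ad6 hP (by simp)]
  simp

lemma croStar_ad6_max (hP : IsPartition P) {B : Finset (Fin n)} (hB : B ∈ P) (i : Fin n)
    (hi : i ∈ B) (him : ∀ c ∈ B, c ≤ i) : croStar (ad6 P B) = croStar P +
      ((Finset.univ.filter (fun i => ∀ c, sb6 P i c → c ≤ i)).filter (fun b => i < b)).card := by
  rw [croStar_ad6 hP (by simp [hB])]
  congr 1
  symm
  apply Finset.card_bij (fun b _ => (i, b))
  · intro b hb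
    simp only [Finset.mem_filter, Finset.mem_univ, true_and] at hb ⊢
    refine ⟨hb.2, hi, ?_, hb.1, ?_⟩
    · intro c hc
      exact him c ((sb6_iff hP hB hi c).mp hc)
    · intro h
      exact absurd (him b h) (not_le.mpr hb.2)
  · intro a _ b _ h
    simpa using h
  · rintro ⟨j, b⟩ h
    simp only [Finset.mem_filter, Finset.mem_univ, true_and] at h
    obtain ⟨h1, h2, h3, h4, h5⟩ := h
    have : j = i := le_antisymm (him j h2) (h3 i ((sb6_iff hP hB h2 i).mpr hi))
    subst this
    exact ⟨b, by simp [h1]; exact h4, rfl⟩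

end P

variable {R : Type*} [CommRing R] (y q : R)

def A6 (n : ℕ) (g : ℕ → R) : R :=
  ∑ P ∈ Finset.univ.filter (fun P : Finset (Finset (Fin n)) => IsPartition P),
    y ^ P.card * q ^ croStar P * g P.card

lemma A6_succ (n : ℕ) (g : ℕ → R) :
    A6 y q (n+1) g = A6 y q n (fun m => y * g (m+1) + g6 q m * g m) := by
  unfold A6
  have : ∑ Q ∈ Finset.univ.filter (fun P : Finset (Finset (Fin (n+1))) => IsPartition P),
      y ^ Q.card * q ^ croStar Q * g Q.card =
      ∑ P ∈ Finset.univ.filter (fun P : Finset (Finset (Fin n)) => IsPartition P),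
        ∑ B ∈ insert ∅ P, y ^ (ad6 P B).card * q ^ croStar (ad6 P B) * g (ad6 P B).card := by
    rw [Finset.sum_sigma']
    symm
    apply Finset.sum_bij (fun x _ => ad6 x.1 x.2)
    · rintro ⟨P, B⟩ h
      simp only [Finset.mem_sigma, Finset.mem_filter, Finset.mem_univ, true_and] at h ⊢
      exact ad6_part h.1 h.2
    · rintro ⟨P, B⟩ h ⟨P', B'⟩ h' e
      simp only [Finset.mem_sigma, Finset.mem_filter, Finset.mem_univ, true_and] at h h'
      obtain ⟨rfl, rfl⟩ := ad6_inj h.1 h'.1 h.2 h'.2 e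
      rfl
    · intro Q hQ
      simp only [Finset.mem_filter, Finset.mem_univ, true_and] at hQ
      obtain ⟨P, B, hP, hB, e⟩ := ad6_surj hQ
      refine ⟨⟨P, B⟩, ?_, e⟩
      simp only [Finset.mem_sigma, Finset.mem_filter, Finset.mem_univ, true_and]
      exact ⟨hP, hB⟩
    · intros; rfl
  rw [this]
  apply Finset.sum_congr rfl
  intro P hP
  simp only [Finset.mem_filter, Finset.mem_univ, true_and] at hP
  have h0 : ∅ ∉ P := fun h => by simpa using hP.1 ∅ h
  rw [Finset.sum_insert h0, croStar_ad6_empty hP, ad6_card, Finset.erase_eq_of_notMem h0]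
  have hs := sum_max6 hP (fun B => y ^ (ad6 P B).card * q ^ croStar (ad6 P B) * g (ad6 P B).card)
    (fun i => y ^ P.card * q ^ croStar P * g P.card * q ^ ((Finset.univ.filter
      (fun i => ∀ c, sb6 P i c → c ≤ i)).filter (fun b => i < b)).card) ?_
  · have hc := sum_max6 hP (fun _ => 1) (fun _ => 1) (fun _ _ _ _ _ => rfl)
    simp only [Finset.sum_const, smul_eq_mul, mul_one] at hc
    rw [hs, ← Finset.mul_sum, geom6, ← hc]
    ring
  · intro B hB i hi him
    beta_reduce
    rw [croStar_ad6_max hP hB i hi him, ad6_card, Finset.card_erase_add_one hB]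
    ring

lemma A6_lin (n : ℕ) (g g' : ℕ → R) (a b : R) :
    A6 y q n (fun m => a * g m + b * g' m) = a * A6 y q n g + b * A6 y q n g' := by
  unfold A6
  rw [Finset.mul_sum, Finset.mul_sum, ← Finset.sum_add_distrib]
  apply Finset.sum_congr rfl
  intros; ring

lemma geo6 (k : ℕ) : geo q (k : ℤ) = g6 q k := by
  simp [geo, g6]

lemma Step_sum6 (f : Step → R) : ∑ s : Step, f s = f .U + f .L + f .D := by
  have : (Finset.univ : Finset Step) = {.U, .L, .D} := rfl
  rw [this]
  simp [add_assoc]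

lemma main6 (n k : ℕ) : pre6 y q n (k : ℤ) = A6 y q n (fun m => E6 q m k) := by
  induction n generalizing k with
  | zero =>
    have hu : Finset.univ.filter (fun P : Finset (Finset (Fin 0)) => IsPartition P) = {∅} := by
      decide
    have hcs : croStar (∅ : Finset (Finset (Fin 0))) = 0 := by decide
    unfold A6 pre6
    rw [hu]
    cases k with
    | zero => simp [hcs, E6, hsum]
    | succ k =>
      have : (0:ℤ) ≠ k + 1 := by omega
      simp [E6, hsum, this]
  | succ n ih =>
    rw [pre6_succ y q n k (by omega), Step_sum6, A6_succ]
    have hD : ((k:ℤ) - Step.D.val) = ((k+1 : ℕ) : ℤ) := by simp [Step.val]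
    have hL : ((k:ℤ) - Step.L.val) = (k : ℤ) := by simp [Step.val]
    rw [hD, hL, ih, ih]
    simp only [wt6, geo6, Int.toNat_natCast]
    cases k with
    | zero =>
      rw [pre6_neg y q n _ (by simp [Step.val])]
      have : (fun m => y * E6 q (m+1) 0 + g6 q m * E6 q m 0) =
          fun m => (y + g6 q 0) * E6 q m 0 + g6 q 1 * E6 q m 1 := by
        funext m
        have := E6_id q m 0
        simp only [E6_zero] at *
        linear_combination this
      rw [this, A6_lin]
      simp
      ring
    | succ k =>
      have hU : (((k+1 : ℕ):ℤ) - Step.U.val) = (k : ℤ) := by simp [Step.val]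
      rw [hU, ih]
      have : (fun m => y * E6 q (m+1) (k+1) + g6 q m * E6 q m (k+1)) =
          fun m => (y * q^k) * E6 q m k + 1 * ((y * q^(k+1) + g6 q (k+1)) * E6 q m (k+1)
            + g6 q (k+2) * E6 q m (k+2)) := by
        funext m
        have := E6_id q m (k+1)
        simp only [E6]
        linear_combination this
      rw [this, A6_lin, A6_lin]
      simp
      ring

end part3

open MvPolynomial in
/-- The block/modified-crossing generating function of set partitions equals the
weighted count of Motzkin paths with up weight `y·q^h`, level weight
`y·q^h + [h]_q`, down weight `[h]_q`.  Here `y = X 0` and `q = X 1`. -/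
theorem stmt6 (n : ℕ) :
    ∑ P ∈ Finset.univ.filter (fun P : Finset (Finset (Fin n)) => IsPartition P),
        (X 0 : MvPolynomial (Fin 2) ℤ) ^ P.card * (X 1) ^ croStar P
    = ∑ M ∈ Finset.univ.filter (fun M : Fin n → Step => IsMotzkin M),
        ∏ i : Fin n,
          (match M i with
            | Step.U => (X 0 : MvPolynomial (Fin 2) ℤ) * (X 1) ^ (hsum M (i : ℕ)).toNat
            | Step.L => (X 0 : MvPolynomial (Fin 2) ℤ) * (X 1) ^ (hsum M (i : ℕ)).toNat
                + geo (X 1 : MvPolynomial (Fin 2) ℤ) (hsum M (i : ℕ))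
            | Step.D => geo (X 1 : MvPolynomial (Fin 2) ℤ) (hsum M (i : ℕ))) := by
  have h := main6 (X 0 : MvPolynomial (Fin 2) ℤ) (X 1) n 0
  unfold A6 pre6 at h
  simp only [E6_zero, mul_one] at h
  rw [Finset.sum_filter (fun M : Fin n → Step => IsMotzkin M)]
  refine h.symm.trans ?_
  apply Finset.sum_congr rfl
  intro M _
  apply if_congr
  · simp [IsMotzkin]
  · apply Finset.prod_congr rfl
    intro i _
    cases M i <;> rfl
  · rfl
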